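/- arXiv:2009.13098 — 2 statements merged into one kernel-verified Lean document; each statement's English description precedes it below -/
import Mathlib

section
/- Let r, L, R, N ≥ 1 be integers. Let A(z) ∈ M_r(ℂ) be the matrix with entries A(z)_{i,i} = 1 for 1 ≤ i ≤ r, A(z)_{i,i+1} = 1 for 1 ≤ i ≤ r−1, A(z)_{r,1} = z, and all other entries 0, and set W(z) = z^{−R}·A(z)^L for z ≠ 0. Suppose 𝓡 : ℂ×ℂ → M_r(ℂ) is a left reproducing kernel of order N for W on the unit circle. Define 𝔯(ω,ζ) := (1/r)·∑_{i=1}^{r} ∑_{k=1}^{r} ω^{r−i}·ζ^{k−1}·𝓡(ω^r, ζ^r)_{i,k}. Then 𝔯 is a scalar bivariate polynomial of degree ≤ rN−1 in each of ω and ζ, and for every complex polynomial p of degree ≤ rN−1 and every ζ ∈ ℂ: ∮_{|ω|=1} p(ω)·r·ω^{−rR}·(1+ω)^L·𝔯(ω,ζ) dω = p(ζ). In other words, the matrix orthogonality for W on the unit circle is equivalent to the scalar orthogonality for the Jacobi-type weight 𝒲(ω) = r·ω^{−rR}(1+ω)^L on the unit circle. -/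
/-- An `m × n` matrix polynomial of degree at most `d`:
`P z = ∑_{ℓ=0}^{d} z ^ ℓ • C ℓ` for some constant matrices `C ℓ`. -/
def IsMatPoly (m n d : ℕ) (P : ℂ → Matrix (Fin m) (Fin n) ℂ) : Prop :=
  ∃ C : ℕ → Matrix (Fin m) (Fin n) ℂ,
    ∀ z : ℂ, P z = ∑ ℓ ∈ Finset.range (d + 1), z ^ ℓ • C ℓ

/-- A scalar polynomial of degree at most `d`. -/
def IsPolyDeg (d : ℕ) (f : ℂ → ℂ) : Prop :=
  ∃ c : ℕ → ℂ, ∀ z : ℂ, f z = ∑ ℓ ∈ Finset.range (d + 1), c ℓ * z ^ ℓ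

/-- Entrywise counterclockwise integral of a matrix-valued function over the circle
`|z| = ρ` centered at the origin. -/
noncomputable def circleIntegralM {m n : ℕ} (ρ : ℝ) (F : ℂ → Matrix (Fin m) (Fin n) ℂ) :
    Matrix (Fin m) (Fin n) ℂ :=
  Matrix.of fun i j => circleIntegral (fun z => F z i j) 0 ρ

/-- `R` is a (matrix-valued) left reproducing kernel of order `N` for the weight `W` on
the circle `|z| = ρ`. -/
def IsLeftRKCircleM (r N : ℕ) (ρ : ℝ) (W : ℂ → Matrix (Fin r) (Fin r) ℂ)
    (R : ℂ → ℂ → Matrix (Fin r) (Fin r) ℂ) : Prop :=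
  (∀ z : ℂ, IsMatPoly r r (N - 1) fun w => R w z) ∧
  (∀ w : ℂ, IsMatPoly r r (N - 1) fun z => R w z) ∧
  ∀ P : ℂ → Matrix (Fin r) (Fin r) ℂ, IsMatPoly r r (N - 1) P →
    ∀ z : ℂ, circleIntegralM ρ (fun w => P w * W w * R w z) = P z

/-- `K` is a scalar left reproducing kernel of order `N` for the weight `W` on the circle
`|z| = ρ`. -/
def IsLeftRKCircleS (N : ℕ) (ρ : ℝ) (W : ℂ → ℂ) (K : ℂ → ℂ → ℂ) : Prop :=
  (∀ z : ℂ, IsPolyDeg (N - 1) fun w => K w z) ∧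
  (∀ w : ℂ, IsPolyDeg (N - 1) (K w)) ∧
  ∀ p : ℂ → ℂ, IsPolyDeg (N - 1) p →
    ∀ z : ℂ, circleIntegral (fun w => p w * W w * K w z) 0 ρ = p z

/-- The `r × r` transition matrix with ones on the diagonal and the superdiagonal and `z`
in the bottom-left corner (for `r = 1` it is `1 + z`). -/
def Amat (r : ℕ) (z : ℂ) : Matrix (Fin r) (Fin r) ℂ :=
  Matrix.of fun i k =>
    (if i = k then 1 else 0) + (if (k : ℕ) = (i : ℕ) + 1 then 1 else 0) +
      (if (i : ℕ) = r - 1 ∧ (k : ℕ) = 0 then z else 0)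

theorem circleIntegral_pow_mul_comp_pow_eq_zero {r n : ℕ} (hr : r ≠ 0) (hn : ¬ r ∣ n + 1)
    (g : ℂ → ℂ) : circleIntegral (fun ω => ω ^ n * g (ω ^ r)) 0 1 = 0 := by
  set q : ℂ := Complex.exp (2 * Real.pi * Complex.I / r) with hq
  have hprim : IsPrimitiveRoot q r := Complex.isPrimitiveRoot_exp r hr
  set f : ℝ → ℂ := fun t => deriv (circleMap 0 1) t •
    (circleMap 0 1 t ^ n * g (circleMap 0 1 t ^ r)) with hf
  have hper : Function.Periodic f (2 * Real.pi) := fun t => by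
    simp only [hf, deriv_circleMap, periodic_circleMap 0 1 t]
  have hrot : ∀ t, f (t + 2 * Real.pi / r) = q ^ (n + 1) * f t := fun t => by
    have hc : circleMap 0 1 (t + 2 * Real.pi / r) = q * circleMap 0 1 t := by
      simp only [circleMap_zero, hq]
      push_cast
      rw [mul_left_comm, ← Complex.exp_add]
      ring_nf
    simp only [hf, deriv_circleMap, hc, mul_pow, hprim.pow_eq_one, one_mul, smul_eq_mul]
    ring
  have hshift : q ^ (n + 1) * (∫ t in (0 : ℝ)..2 * Real.pi, f t) =
      ∫ t in (0 : ℝ)..2 * Real.pi, f t := by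
    rw [← intervalIntegral.integral_const_mul]
    simp_rw [← hrot]
    rw [intervalIntegral.integral_comp_add_right, zero_add, add_comm (2 * Real.pi)]
    simpa using hper.intervalIntegral_add_eq (2 * Real.pi / r) 0
  change (∫ t in (0 : ℝ)..2 * Real.pi, f t) = 0
  by_contra h
  exact hn ((hprim.pow_eq_one_iff_dvd _).1 ((mul_eq_right₀ h).1 hshift))

theorem circleIntegral_pow_mul_comp_pow {r : ℕ} (hr : r ≠ 0) {g : ℂ → ℂ}
    (hg : ContinuousOn g (Metric.sphere 0 1)) :
    circleIntegral (fun ω => ω ^ (r - 1) * g (ω ^ r)) 0 1 = circleIntegral g 0 1 := by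
  set f : ℝ → ℂ := fun t => deriv (circleMap 0 1) t • g (circleMap 0 1 t) with hf
  have hper : Function.Periodic f (2 * Real.pi) := fun t => by
    simp only [hf, deriv_circleMap, periodic_circleMap 0 1 t]
  have hcont : Continuous f := by
    simp only [hf, deriv_circleMap]
    refine ((continuous_circleMap 0 1).mul continuous_const).smul
      (hg.comp_continuous (continuous_circleMap 0 1) ?_)
    exact fun t => circleMap_mem_sphere 0 zero_le_one t
  have hrC : (r : ℝ) ≠ 0 := by exact_mod_cast hr
  have hpt : ∀ t : ℝ, deriv (circleMap 0 1) t • (circleMap 0 1 t ^ (r - 1) *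
      g (circleMap 0 1 t ^ r)) = f (r * t) := fun t => by
    have hc : circleMap 0 1 (r * t) = circleMap 0 1 t ^ r := by
      simp [circleMap_zero, ← Complex.exp_nat_mul, mul_assoc]
    obtain ⟨s, rfl⟩ := Nat.exists_eq_succ_of_ne_zero hr
    simp only [hf, deriv_circleMap, hc, smul_eq_mul, Nat.succ_sub_one, pow_succ]
    ring
  change (∫ t in (0 : ℝ)..2 * Real.pi, _) = ∫ t in (0 : ℝ)..2 * Real.pi, f t
  simp_rw [hpt]
  rw [intervalIntegral.integral_comp_mul_left _ hrC, mul_zero]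
  have h := hper.intervalIntegral_add_zsmul_eq r 0 (fun a b => hcont.intervalIntegrable a b)
  simp only [zero_add, zsmul_eq_mul, Int.cast_natCast] at h
  rw [h, Complex.real_smul, ← mul_assoc]
  push_cast
  rw [inv_mul_cancel₀ (by exact_mod_cast hr), one_mul]

theorem vecMul_Amat {r : ℕ} (ω : ℂ) :
    Matrix.vecMul (fun i : Fin r => ω ^ (r - 1 - (i : ℕ))) (Amat r (ω ^ r)) =
      (1 + ω) • fun i : Fin r => ω ^ (r - 1 - (i : ℕ)) := by
  funext k
  have hk := k.isLt
  simp only [Matrix.vecMul, dotProduct, Amat, Matrix.of_apply, mul_add, Finset.sum_add_distrib,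
    Pi.smul_apply, smul_eq_mul, mul_ite, mul_one, mul_zero, Finset.sum_ite_eq', Finset.mem_univ,
    if_true]
  rw [add_assoc, add_mul, one_mul]
  congr 1
  by_cases hk0 : (k : ℕ) = 0
  · rw [Finset.sum_eq_zero fun i _ => if_neg (by omega),
      Finset.sum_eq_single (⟨r - 1, by omega⟩ : Fin r)]
    · simp only [hk0, and_self, if_true, Nat.sub_self, Nat.sub_zero, pow_zero, one_mul, zero_add,
        ← pow_succ']
      congr 1
      omega
    · exact fun i _ hi => if_neg fun h => hi (Fin.ext h.1)
    · simp
  · rw [Finset.sum_eq_single (⟨k - 1, by omega⟩ : Fin r),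
      Finset.sum_eq_zero fun i _ => if_neg (by tauto), if_pos (by simp only; omega), add_zero,
      ← pow_succ']
    · congr 1
      simp only
      omega
    · exact fun i _ hi => if_neg fun h => hi (Fin.ext (by simp only; omega))
    · simp

theorem vecMul_Amat_pow {r : ℕ} (ω : ℂ) (L : ℕ) :
    Matrix.vecMul (fun i : Fin r => ω ^ (r - 1 - (i : ℕ))) (Amat r (ω ^ r) ^ L) =
      (1 + ω) ^ L • fun i : Fin r => ω ^ (r - 1 - (i : ℕ)) := by
  induction L with
  | zero => simp
  | succ L ih =>
    rw [pow_succ, ← Matrix.vecMul_vecMul, ih, Matrix.smul_vecMul, vecMul_Amat, smul_smul, pow_succ]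

theorem continuous_Amat (r : ℕ) : Continuous (Amat r) := by
  refine continuous_matrix fun i k => ?_
  simp only [Amat, Matrix.of_apply]
  split_ifs <;> fun_prop

theorem IsMatPoly.continuous {m n d : ℕ} {P : ℂ → Matrix (Fin m) (Fin n) ℂ}
    (hP : IsMatPoly m n d P) : Continuous P := by
  obtain ⟨C, hC⟩ := hP
  rw [funext hC]
  fun_prop

theorem isMatPoly_pow_smul_one (r : ℕ) {m d : ℕ} (hm : m ≤ d) :
    IsMatPoly r r d fun w => w ^ m • (1 : Matrix (Fin r) (Fin r) ℂ) :=
  ⟨fun ℓ => if ℓ = m then 1 else 0, fun z => by simp [Nat.lt_succ_of_le hm]⟩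

namespace IsPolyDeg

theorem const_mul {d : ℕ} {f : ℂ → ℂ} (hf : IsPolyDeg d f) (a : ℂ) :
    IsPolyDeg d fun z => a * f z := by
  obtain ⟨c, hc⟩ := hf
  exact ⟨fun ℓ => a * c ℓ, fun z => by simp only [hc, Finset.mul_sum, mul_assoc]⟩

theorem sum {ι : Type*} {d : ℕ} (s : Finset ι) {f : ι → ℂ → ℂ}
    (hf : ∀ i ∈ s, IsPolyDeg d (f i)) : IsPolyDeg d fun z => ∑ i ∈ s, f i z := by
  choose! c hc using hf
  refine ⟨fun ℓ => ∑ i ∈ s, c i ℓ, fun z => ?_⟩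
  simp only [Finset.sum_mul]
  rw [Finset.sum_comm]
  exact Finset.sum_congr rfl fun i hi => hc i hi z

theorem pow {e d : ℕ} (he : e ≤ d) : IsPolyDeg d fun z => z ^ e :=
  ⟨fun ℓ => if ℓ = e then 1 else 0, fun z => by simp [Nat.lt_succ_of_le he]⟩

end IsPolyDeg

theorem IsMatPoly.isPolyDeg_pow_mul {m n d r e D : ℕ} {P : ℂ → Matrix (Fin m) (Fin n) ℂ}
    (hP : IsMatPoly m n d P) (hD : e + r * d ≤ D) (i : Fin m) (k : Fin n) :
    IsPolyDeg D fun z => z ^ e * P (z ^ r) i k := by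
  obtain ⟨C, hC⟩ := hP
  have h : (fun z => z ^ e * P (z ^ r) i k) =
      fun z => ∑ ℓ ∈ Finset.range (d + 1), C ℓ i k * z ^ (e + r * ℓ) := by
    funext z
    simp only [hC, Matrix.sum_apply, Matrix.smul_apply, smul_eq_mul, Finset.mul_sum, pow_add,
      pow_mul]
    exact Finset.sum_congr rfl fun _ _ => by ring
  rw [h]
  refine IsPolyDeg.sum _ fun ℓ hℓ => (IsPolyDeg.pow (le_trans ?_ hD)).const_mul _
  have := Nat.mul_le_mul_left r (Nat.lt_succ_iff.1 (Finset.mem_range.1 hℓ))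
  omega

/-- Integrating a monomial against the scalar kernel picks out one row of the matrix integral. -/
theorem circleIntegral_pow_mul_scalarKernel {r L R N : ℕ} (hr : r ≠ 0)
    {K : ℂ → ℂ → Matrix (Fin r) (Fin r) ℂ}
    (hK : IsLeftRKCircleM r N 1 (fun z => z ^ (-(R : ℤ)) • Amat r z ^ L) K)
    {ℓ : ℕ} (hℓ : ℓ / r ≤ N - 1) (ζ : ℂ) :
    CircleIntegrable (fun ω =>
        ω ^ ℓ * ((r : ℂ) * ω ^ (-((r * R : ℕ) : ℤ)) * (1 + ω) ^ L) *
          ((1 / (r : ℂ)) * ∑ i : Fin r, ∑ k : Fin r,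
            ω ^ (r - 1 - (i : ℕ)) * ζ ^ (k : ℕ) * K (ω ^ r) (ζ ^ r) i k)) 0 1 ∧
      circleIntegral (fun ω =>
        ω ^ ℓ * ((r : ℂ) * ω ^ (-((r * R : ℕ) : ℤ)) * (1 + ω) ^ L) *
          ((1 / (r : ℂ)) * ∑ i : Fin r, ∑ k : Fin r,
            ω ^ (r - 1 - (i : ℕ)) * ζ ^ (k : ℕ) * K (ω ^ r) (ζ ^ r) i k)) 0 1 = ζ ^ ℓ := by
  obtain ⟨hK₁, -, hrep⟩ := hK
  have hrC : (r : ℂ) ≠ 0 := by exact_mod_cast hr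
  set m := ℓ / r
  set j := ℓ % r
  have hjr : j < r := Nat.mod_lt _ (Nat.pos_of_ne_zero hr)
  have hdiv : ℓ = r * m + j := (Nat.div_add_mod ℓ r).symm
  set G : ℂ → Matrix (Fin r) (Fin r) ℂ := fun w =>
    (w ^ m • (1 : Matrix (Fin r) (Fin r) ℂ)) * (w ^ (-(R : ℤ)) • Amat r w ^ L) * K w (ζ ^ r)
    with hG
  have hGcont : ContinuousOn G (Metric.sphere 0 1) := by
    have hz : ContinuousOn (fun w : ℂ => w ^ (-(R : ℤ))) (Metric.sphere 0 1) := fun w hw =>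
      (continuousAt_zpow₀ w _ (Or.inl (ne_zero_of_mem_unit_sphere ⟨w, hw⟩))).continuousWithinAt
    exact (((isMatPoly_pow_smul_one r hℓ).continuous.continuousOn).mul
      (hz.smul ((continuous_Amat r).pow L).continuousOn)).mul (hK₁ _).continuous.continuousOn
  have hGik (i k : Fin r) : ContinuousOn (fun w => G w i k) (Metric.sphere 0 1) :=
    (continuous_id.matrix_elem i k).comp_continuousOn hGcont
  have hGint (i k : Fin r) : circleIntegral (fun w => G w i k) 0 1 =
      (ζ ^ r) ^ m * (1 : Matrix (Fin r) (Fin r) ℂ) i k := by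
    have h := congrFun (congrFun (hrep _ (isMatPoly_pow_smul_one r hℓ) (ζ ^ r)) i) k
    simpa only [circleIntegralM, Matrix.of_apply, Matrix.smul_apply, smul_eq_mul] using h
  have hpt : (fun ω => ω ^ ℓ * ((r : ℂ) * ω ^ (-((r * R : ℕ) : ℤ)) * (1 + ω) ^ L) *
          ((1 / (r : ℂ)) * ∑ i : Fin r, ∑ k : Fin r,
            ω ^ (r - 1 - (i : ℕ)) * ζ ^ (k : ℕ) * K (ω ^ r) (ζ ^ r) i k)) =
      fun ω => ∑ k : Fin r, ∑ i : Fin r,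
        ζ ^ (k : ℕ) * (ω ^ (j + (r - 1 - (i : ℕ))) * G (ω ^ r) i k) := by
    funext ω
    have hz : ω ^ (-((r * R : ℕ) : ℤ)) = (ω ^ r) ^ (-(R : ℤ)) := by
      rw [zpow_neg, zpow_neg, zpow_natCast, zpow_natCast, pow_mul]
    have hrow (k : Fin r) : (1 + ω) ^ L *
        ∑ i : Fin r, ω ^ (r - 1 - (i : ℕ)) * K (ω ^ r) (ζ ^ r) i k =
        ∑ i : Fin r, ω ^ (r - 1 - (i : ℕ)) * (Amat r (ω ^ r) ^ L * K (ω ^ r) (ζ ^ r)) i k := by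
      have h := congrFun (congrArg (fun v => Matrix.vecMul v (K (ω ^ r) (ζ ^ r)))
        (vecMul_Amat_pow (r := r) ω L)) k
      simp only [Matrix.vecMul_vecMul, Matrix.smul_vecMul, Pi.smul_apply, smul_eq_mul] at h
      exact h.symm
    calc _ = ∑ k : Fin r, ω ^ ℓ * (ω ^ r) ^ (-(R : ℤ)) * ζ ^ (k : ℕ) * ((1 + ω) ^ L *
            ∑ i : Fin r, ω ^ (r - 1 - (i : ℕ)) * K (ω ^ r) (ζ ^ r) i k) := by
          rw [hz, Finset.sum_comm, Finset.mul_sum, Finset.mul_sum]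
          refine Finset.sum_congr rfl fun k _ => ?_
          simp only [Finset.mul_sum]
          refine Finset.sum_congr rfl fun i _ => ?_
          field_simp
      _ = _ := by
          refine Finset.sum_congr rfl fun k _ => ?_
          rw [hrow, Finset.mul_sum]
          refine Finset.sum_congr rfl fun i _ => ?_
          simp only [hG, Matrix.smul_mul, Matrix.mul_smul, one_mul, Matrix.smul_apply,
            smul_eq_mul, hdiv, pow_add, pow_mul]
          ring
  have hint (i k : Fin r) : CircleIntegrable (fun ω =>
      ζ ^ (k : ℕ) * (ω ^ (j + (r - 1 - (i : ℕ))) * G (ω ^ r) i k)) 0 1 := by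
    refine ContinuousOn.circleIntegrable zero_le_one (continuousOn_const.mul
      ((continuous_pow _).continuousOn.mul ((hGik i k).comp (continuous_pow r).continuousOn ?_)))
    intro w hw
    simp only [mem_sphere_iff_norm, sub_zero, norm_pow] at hw ⊢
    rw [hw, one_pow]
  have hsum (k : Fin r) : CircleIntegrable (fun ω => ∑ i : Fin r,
      ζ ^ (k : ℕ) * (ω ^ (j + (r - 1 - (i : ℕ))) * G (ω ^ r) i k)) 0 1 :=
    CircleIntegrable.fun_sum _ fun i _ => hint i k
  have hval (i k : Fin r) : circleIntegral (fun ω =>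
      ζ ^ (k : ℕ) * (ω ^ (j + (r - 1 - (i : ℕ))) * G (ω ^ r) i k)) 0 1 =
        if i = ⟨j, hjr⟩ then if k = ⟨j, hjr⟩ then ζ ^ ℓ else 0 else 0 := by
    rw [circleIntegral.integral_const_mul]
    split_ifs with hi hk
    · subst hi hk
      have : j + (r - 1 - j) = r - 1 := by omega
      simp only [this]
      rw [circleIntegral_pow_mul_comp_pow hr (g := fun w => G w _ _) (hGik _ _), hGint,
        Matrix.one_apply_eq, mul_one, ← pow_mul, ← pow_add, hdiv, add_comm]
    · subst hi
      have : j + (r - 1 - j) = r - 1 := by omega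
      simp only [this]
      rw [circleIntegral_pow_mul_comp_pow hr (g := fun w => G w _ _) (hGik _ _), hGint,
        Matrix.one_apply_ne (Ne.symm hk), mul_zero, mul_zero]
    · have hi' : (i : ℕ) ≠ j := fun h => hi (Fin.ext h)
      have hir := i.isLt
      rw [circleIntegral_pow_mul_comp_pow_eq_zero hr ?_ (fun w => G w i k), mul_zero]
      rintro ⟨c, hc⟩
      rcases c with _ | _ | c
      · omega
      · omega
      · have : r * (c + 1 + 1) = r * c + 2 * r := by ring
        have := Nat.zero_le (r * c)
        omega
  rw [hpt]
  refine ⟨CircleIntegrable.fun_sum _ fun k _ => hsum k, ?_⟩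
  rw [circleIntegral.integral_fun_sum fun k _ => hsum k]
  simp only [circleIntegral.integral_fun_sum fun i _ => hint i _, hval, Finset.sum_ite_eq',
    Finset.mem_univ, if_true]

/-- The matrix orthogonality for `W(z) = z^{-R} A(z)^L` on the unit
circle is equivalent to the scalar orthogonality for the Jacobi-type weight
`𝒲(ω) = r ω^{-rR} (1+ω)^L` on the unit circle: the scalar kernel
`𝔯(ω,ζ) = (1/r) ∑_{i,k} ω^{r-i} ζ^{k-1} 𝓡(ω^r,ζ^r)_{i,k}` is a bivariate polynomial of
degree `≤ rN - 1` in each variable that reproduces all polynomials of degree `≤ rN - 1`. -/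
theorem stmt10 (r L R N : ℕ) (hr : 1 ≤ r) (hL : 1 ≤ L) (hR : 1 ≤ R) (hN : 1 ≤ N)
    (K : ℂ → ℂ → Matrix (Fin r) (Fin r) ℂ)
    (hK : IsLeftRKCircleM r N 1 (fun z => z ^ (-(R : ℤ)) • Amat r z ^ L) K) :
    (∀ ζ : ℂ, IsPolyDeg (r * N - 1) fun ω =>
      (1 / (r : ℂ)) * ∑ i : Fin r, ∑ k : Fin r,
        ω ^ (r - 1 - (i : ℕ)) * ζ ^ (k : ℕ) * K (ω ^ r) (ζ ^ r) i k) ∧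
    (∀ ω : ℂ, IsPolyDeg (r * N - 1) fun ζ =>
      (1 / (r : ℂ)) * ∑ i : Fin r, ∑ k : Fin r,
        ω ^ (r - 1 - (i : ℕ)) * ζ ^ (k : ℕ) * K (ω ^ r) (ζ ^ r) i k) ∧
    ∀ p : ℂ → ℂ, IsPolyDeg (r * N - 1) p → ∀ ζ : ℂ,
      circleIntegral (fun ω =>
        p ω * ((r : ℂ) * ω ^ (-((r * R : ℕ) : ℤ)) * (1 + ω) ^ L) *
          ((1 / (r : ℂ)) * ∑ i : Fin r, ∑ k : Fin r,
            ω ^ (r - 1 - (i : ℕ)) * ζ ^ (k : ℕ) * K (ω ^ r) (ζ ^ r) i k)) 0 1 = p ζ := by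
  have hr0 : r ≠ 0 := by omega
  have hdeg {e : ℕ} (he : e ≤ r - 1) : e + r * (N - 1) ≤ r * N - 1 := by
    obtain ⟨N, rfl⟩ := Nat.exists_eq_add_of_le' hN
    rw [Nat.add_sub_cancel, Nat.mul_succ]
    omega
  refine ⟨fun ζ => ?_, fun ω => ?_, fun p hp ζ => ?_⟩
  · refine (IsPolyDeg.sum _ fun i _ => IsPolyDeg.sum _ fun k _ => ?_).const_mul _
    convert ((hK.1 (ζ ^ r)).isPolyDeg_pow_mul (r := r) (e := r - 1 - i)
      (hdeg (by omega)) i k).const_mul (ζ ^ (k : ℕ)) using 2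
    ring
  · refine (IsPolyDeg.sum _ fun i _ => IsPolyDeg.sum _ fun k _ => ?_).const_mul _
    convert ((hK.2.1 (ω ^ r)).isPolyDeg_pow_mul (r := r) (e := k)
      (hdeg (by omega)) i k).const_mul (ω ^ (r - 1 - (i : ℕ))) using 2
    ring
  · obtain ⟨c, hc⟩ := hp
    have hmono {ℓ : ℕ} (hℓ : ℓ ∈ Finset.range (r * N - 1 + 1)) :=
      circleIntegral_pow_mul_scalarKernel (ℓ := ℓ) hr0 hK (by
        have h : ℓ < r * N := by
          have := Finset.mem_range.1 hℓ
          have := Nat.mul_pos hr hN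
          omega
        exact Nat.le_sub_one_of_lt (Nat.div_lt_of_lt_mul h)) ζ
    simp only [hc, Finset.sum_mul, mul_assoc (c _)]
    refine (circleIntegral.integral_fun_sum fun ℓ hℓ =>
      CircleIntegrable.const_smul (a := c ℓ) (hmono hℓ).1).trans ?_
    exact Finset.sum_congr rfl fun ℓ hℓ =>
      (circleIntegral.integral_const_mul _ _ _ _).trans (congrArg (c ℓ * ·) (hmono hℓ).2)
end

section
/- Let r ≥ 2 and m, n, L ≥ 1 be integers with L ≥ 2, and set M = r·m, N = r·n. Let A(z) ∈ M_r(ℂ) have entries A(z)_{i,i} = 1 for 1 ≤ i ≤ r, A(z)_{i,i+1} = 1 for 1 ≤ i ≤ r−1, A(z)_{r,1} = z, and all other entries 0; set W(z) = z^{−(m+n)}·A(z)^L and W̃(z) = (1+z)^L·z^{−M−N} for z ≠ 0. Assume 𝓡 : ℂ×ℂ → M_r(ℂ) is a left reproducing kernel of order n for W on the unit circle, and assume 𝓡̃ : ℂ×ℂ → ℂ is a scalar left reproducing kernel of order rn for W̃ on the unit circle which is moreover unique (any scalar bivariate polynomial of degree ≤ rn−1 in each variable satisfying the same reproducing property equals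 𝓡̃). Then for all integers x₁, x₂ with 1 ≤ x₁, x₂ ≤ L−1 and all y₁, y₂ ∈ ℤ, writing χ = 1 if x₁ > x₂ and χ = 0 otherwise, and writing ⌊y/r⌋ for the integer floor of y/r and (y mod r) = y − r·⌊y/r⌋ ∈ {0,…,r−1}: (1/(2πi))·∮_{|w|=1}∮_{|z|=1} (1+w)^{L−x₂}·w^{y₂−M−N}·𝓡̃(w,z)·(1+z)^{x₁}·z^{−y₁−1} dz dw − (χ/(2πi))·∮_{|z|=1} (1+z)^{x₁−x₂}·z^{y₂−y₁−1} dz = (1/(2πi))·∮_{|w|=1}∮_{|z|=1} e_{(y₂ mod r)+1}ᵀ·w^{⌊y₂/r⌋−m−n}·A(w)^{L−x₂}·𝓡(w,z)·A(z)^{x₁}·z^{−⌊y₁/r⌋−1}·e_{(y₁ mod r)+1} dz dw − (χ/(2πi))·∮_{|z|=1} e_{(y₂ mod r)+1}ᵀ·A(z)^{x₁−x₂}·e_{(y₁ mod r)+1}·z^{⌊y₂/r⌋−⌊y₁/r⌋−1} dz. -/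
/-- The index `y mod r` as an element of `Fin r`. -/
def modIdx (r : ℕ) (hr : 0 < r) (y : ℤ) : Fin r :=
  ⟨(y % (r : ℤ)).toNat, by
    have h0 : (0 : ℤ) < (r : ℤ) := by exact_mod_cast hr
    have h1 : y % (r : ℤ) < (r : ℤ) := Int.emod_lt_of_pos y h0
    have h2 : 0 ≤ y % (r : ℤ) := Int.emod_nonneg y (by omega)
    omega⟩

open Finset in
/-- A function of two variables which is polynomial of bounded degree in each variable separately
is jointly polynomial. -/
theorem exists_coeff_of_isPolyDeg_isPolyDeg {d : ℕ} {f : ℂ → ℂ → ℂ}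
    (h₁ : ∀ z, IsPolyDeg d fun w => f w z) (h₂ : ∀ w, IsPolyDeg d (f w)) :
    ∃ c : ℕ → ℕ → ℂ, ∀ w z,
      f w z = ∑ a ∈ range (d + 1), ∑ b ∈ range (d + 1), c a b * (w ^ a * z ^ b) := by
  choose e he using h₂
  have hinj : Set.InjOn (fun k : ℕ => (k : ℂ)) (range (d + 1)) := fun x _ y _ h => by
    simpa using h
  refine ⟨fun a b => ∑ k ∈ range (d + 1),
    (Lagrange.basis (range (d + 1)) (fun k : ℕ => (k : ℂ)) k).coeff a * e k b, fun w z => ?_⟩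
  obtain ⟨q, hq⟩ := h₁ z
  set p : Polynomial ℂ := ∑ l ∈ range (d + 1), Polynomial.C (q l) * Polynomial.X ^ l with hp
  have hpe : ∀ w, p.eval w = f w z := fun w => by
    rw [show f w z = _ from hq w, hp, Polynomial.eval_finsetSum]; simp
  have hpd : p.degree < #(range (d + 1)) := by
    rw [card_range, Polynomial.degree_lt_iff_coeff_zero]
    intro k hk
    simp only [hp, Polynomial.finsetSum_coeff, Polynomial.coeff_C_mul_X_pow]
    exact sum_eq_zero fun l hl => if_neg (by have := mem_range.1 hl; omega)
  have hint := Lagrange.eq_interpolate hinj hpd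
  have hb : ∀ k ∈ range (d + 1),
      (Lagrange.basis (range (d + 1)) (fun k : ℕ => (k : ℂ)) k).eval w =
        ∑ a ∈ range (d + 1),
          (Lagrange.basis (range (d + 1)) (fun k : ℕ => (k : ℂ)) k).coeff a * w ^ a :=
    fun k hk => Polynomial.eval_eq_sum_range' (by
      have := Lagrange.degree_basis hinj hk
      have := Polynomial.natDegree_eq_of_degree_eq_some this
      rw [card_range] at this
      omega) w
  rw [← hpe w, hint, Lagrange.interpolate_apply, Polynomial.eval_finsetSum]
  calc _ = ∑ k ∈ range (d + 1), ∑ a ∈ range (d + 1), ∑ b ∈ range (d + 1),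
        (Lagrange.basis (range (d + 1)) (fun k : ℕ => (k : ℂ)) k).coeff a * e k b *
          (w ^ a * z ^ b) := by
        refine sum_congr rfl fun k hk => ?_
        rw [Polynomial.eval_mul, Polynomial.eval_C, hb k hk, hpe, he, sum_mul_sum, sum_comm]
        exact sum_congr rfl fun a _ => sum_congr rfl fun b _ => by ring
    _ = _ := by
        rw [sum_comm]
        refine sum_congr rfl fun a _ => ?_
        rw [sum_comm]
        exact sum_congr rfl fun b _ => by rw [sum_mul]

theorem IsMatPoly.apply {m n d : ℕ} {P : ℂ → Matrix (Fin m) (Fin n) ℂ} (h : IsMatPoly m n d P)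
    (i : Fin m) (j : Fin n) : IsPolyDeg d fun z => P z i j := by
  obtain ⟨C, hC⟩ := h
  exact ⟨fun l => C l i j, fun z => by simp [hC, Matrix.sum_apply, mul_comm]⟩

theorem IsPolyDeg.sum_s15 {ι : Type*} {d : ℕ} (s : Finset ι) {f : ι → ℂ → ℂ}
    (h : ∀ t ∈ s, IsPolyDeg d (f t)) : IsPolyDeg d fun z => ∑ t ∈ s, f t z := by
  choose! c hc using h
  refine ⟨fun l => ∑ t ∈ s, c t l, fun z => ?_⟩
  simp only [Finset.sum_mul]
  rw [Finset.sum_comm]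
  exact Finset.sum_congr rfl fun t ht => hc t ht z

theorem isPolyDeg_const_mul_pow {d k : ℕ} (hk : k ≤ d) (c : ℂ) :
    IsPolyDeg d fun z => c * z ^ k := by
  refine ⟨fun l => if l = k then c else 0, fun z => ?_⟩
  simp [ite_mul, Finset.sum_ite_eq', Nat.lt_succ_of_le hk]

theorem continuous_Amat_pow_apply (r k : ℕ) (i j : Fin r) :
    Continuous fun z => (Amat r z ^ k) i j := by
  have h : Continuous (Amat r) := by
    refine continuous_matrix fun i j => ?_
    simp only [Amat, Matrix.of_apply]
    refine Continuous.add continuous_const ?_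
    split_ifs <;> fun_prop
  exact (h.pow k).matrix_elem i j

theorem circleIntegrable_zpow_mul (p : ℤ) {f : ℂ → ℂ} (hf : Continuous f) :
    CircleIntegrable (fun z => z ^ p * f z) 0 1 := by
  refine ContinuousOn.circleIntegrable zero_le_one fun z hz => ?_
  have hz0 : z ≠ 0 := ne_zero_of_mem_unit_sphere ⟨z, hz⟩
  exact ((continuousAt_zpow₀ z p (Or.inl hz0)).mul hf.continuousAt).continuousWithinAt

theorem circleIntegral_zpow (p : ℤ) :
    circleIntegral (fun z => z ^ p) 0 1 =
      if p = -1 then 2 * (Real.pi : ℂ) * Complex.I else 0 := by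
  split_ifs with h
  · subst h
    simpa using circleIntegral.integral_sub_center_inv (0 : ℂ) (one_ne_zero : (1 : ℝ) ≠ 0)
  · simpa only [sub_zero] using circleIntegral.integral_sub_zpow_of_ne h 0 0 1

theorem circleIntegral_congr_unit {f g : ℂ → ℂ} (h : ∀ z, z ≠ 0 → f z = g z) :
    circleIntegral f 0 1 = circleIntegral g 0 1 :=
  circleIntegral.integral_congr zero_le_one fun z hz =>
    h z (ne_zero_of_mem_unit_sphere ⟨z, hz⟩)

theorem circleIntegral_sum_const_mul {ι : Type*} (s : Finset ι) (c : ι → ℂ) {f : ι → ℂ → ℂ}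
    (hf : ∀ t ∈ s, CircleIntegrable (f t) 0 1) :
    circleIntegral (fun z => ∑ t ∈ s, c t * f t z) 0 1 =
      ∑ t ∈ s, c t * circleIntegral (f t) 0 1 := by
  have h : ∀ t ∈ s, CircleIntegrable (fun z => c t * f t z) 0 1 := fun t ht =>
    (hf t ht).const_mul _
  rw [circleIntegral.integral_fun_sum h]
  exact Finset.sum_congr rfl fun t _ => circleIntegral.integral_const_mul _ _ _ _

/-- A double circle integral of a finite sum of products of functions of one variable. -/
theorem circleIntegral_circleIntegral_of_eq_sum {ι : Type*} (s : Finset ι) (c : ι → ℂ)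
    {u v : ι → ℂ → ℂ} {F : ℂ → ℂ → ℂ} (hu : ∀ t ∈ s, CircleIntegrable (u t) 0 1)
    (hv : ∀ t ∈ s, CircleIntegrable (v t) 0 1)
    (hF : ∀ w, w ≠ 0 → ∀ z, z ≠ 0 → F w z = ∑ t ∈ s, c t * (u t w * v t z)) :
    circleIntegral (fun w => circleIntegral (fun z => F w z) 0 1) 0 1 =
      ∑ t ∈ s, c t * (circleIntegral (u t) 0 1 * circleIntegral (v t) 0 1) := by
  have h : ∀ w, w ≠ 0 → circleIntegral (fun z => F w z) 0 1 =
      ∑ t ∈ s, (c t * circleIntegral (v t) 0 1) * u t w := fun w hw => by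
    rw [circleIntegral_congr_unit (g := fun z => ∑ t ∈ s, (c t * u t w) * v t z)
      fun z hz => by rw [hF w hw z hz]; simp only [mul_assoc],
      circleIntegral_sum_const_mul s _ hv]
    exact Finset.sum_congr rfl fun t _ => by ring
  rw [circleIntegral_congr_unit h, circleIntegral_sum_const_mul s _ hu]
  exact Finset.sum_congr rfl fun t _ => by ring

theorem Amat_mul_apply {r : ℕ} (hr : 2 ≤ r) (z : ℂ) (B : Matrix (Fin r) (Fin r) ℂ)
    (i j : Fin r) :
    (Amat r z * B) i j = B i j +
      if h : (i : ℕ) + 1 < r then B ⟨i + 1, h⟩ j else z * B ⟨0, by omega⟩ j := by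
  simp only [Matrix.mul_apply, Amat, Matrix.of_apply, add_mul, Finset.sum_add_distrib,
    ite_mul, one_mul, zero_mul, Finset.sum_ite_eq, Finset.mem_univ, if_true, add_assoc]
  congr 1
  split_ifs with h
  · rw [Finset.sum_eq_single ⟨i + 1, h⟩, Finset.sum_eq_zero, if_pos rfl, add_zero]
    · intro x _
      exact if_neg (by omega)
    · intro x _ hx
      exact if_neg fun h' => hx (Fin.ext h')
    · simp
  · rw [Finset.sum_eq_zero, Finset.sum_eq_single ⟨0, by omega⟩, if_pos ⟨by omega, rfl⟩, zero_add]
    · intro x _ hx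
      exact if_neg fun h' => hx (Fin.ext h'.2)
    · simp
    · intro x _
      exact if_neg (by omega)

/-- Fourier coefficients of the entries of `Amat r z ^ k` are Fourier coefficients of
`(1 + z) ^ k`. -/
theorem circleIntegral_zpow_mul_Amat_pow {r : ℕ} (hr : 2 ≤ r) (k : ℕ) (s p : ℤ) (i j : Fin r)
    (hp : p = r * s + r - 1 + (i : ℕ) - (j : ℕ)) :
    circleIntegral (fun z => z ^ s * (Amat r z ^ k) i j) 0 1 =
      circleIntegral (fun z => z ^ p * (1 + z) ^ k) 0 1 := by
  induction k generalizing s p i with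
  | zero =>
    simp only [pow_zero, mul_one, Matrix.one_apply, circleIntegral_zpow]
    have hi := i.2
    have hj := j.2
    have key : p = -1 ↔ s = -1 ∧ i = j := by
      constructor
      · intro h
        have h1 : (r : ℤ) * (s + 1) = (j : ℕ) - (i : ℕ) := by linarith
        have h2 : s + 1 = 0 := by
          have : (r : ℤ) * (s + 1) < r * 1 := by omega
          have := lt_of_mul_lt_mul_left this (by omega)
          have : (r : ℤ) * (-1) < r * (s + 1) := by omega
          have := lt_of_mul_lt_mul_left this (by omega)
          omega
        rw [h2, mul_zero] at h1
        exact ⟨by omega, Fin.ext (by omega)⟩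
      · rintro ⟨rfl, rfl⟩
        rw [hp]; ring
    by_cases hij : i = j
    · simp [hij, key, circleIntegral_zpow]
    · simp [hij, key, circleIntegral]
  | succ k ih =>
    have hc : ∀ q : ℤ, CircleIntegrable (fun z : ℂ => z ^ q * (1 + z) ^ k) 0 1 := fun q =>
      circleIntegrable_zpow_mul q (by fun_prop)
    have hA : ∀ (q : ℤ) (i : Fin r), CircleIntegrable (fun z => z ^ q * (Amat r z ^ k) i j) 0 1 :=
      fun q i => circleIntegrable_zpow_mul q (continuous_Amat_pow_apply r k i j)
    have hR : circleIntegral (fun z : ℂ => z ^ p * (1 + z) ^ (k + 1)) 0 1 =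
        circleIntegral (fun z : ℂ => z ^ p * (1 + z) ^ k) 0 1 +
          circleIntegral (fun z : ℂ => z ^ (p + 1) * (1 + z) ^ k) 0 1 := by
      rw [← circleIntegral.integral_add (hc _) (hc _)]
      refine circleIntegral_congr_unit fun z hz => ?_
      rw [zpow_add_one₀ hz]; ring
    rw [hR, ← ih s p i hp]
    simp only [pow_succ', Amat_mul_apply hr]
    split_ifs with h
    · rw [← ih s (p + 1) ⟨i + 1, h⟩ (by rw [hp]; push_cast; ring),
        ← circleIntegral.integral_add (hA _ _) (hA _ _)]
      exact circleIntegral_congr_unit fun z _ => mul_add _ _ _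
    · have hi : (i : ℤ) = r - 1 := by omega
      rw [← ih (s + 1) (p + 1) ⟨0, by omega⟩ (by push_cast; linear_combination hp + hi),
        ← circleIntegral.integral_add (hA _ _) (hA _ _)]
      refine circleIntegral_congr_unit fun z hz => ?_
      rw [zpow_add_one₀ hz]; ring

theorem sum_range_product_fin (r n : ℕ) (f : (ℕ × ℕ) × Fin r × Fin r → ℂ) :
    ∑ t ∈ (Finset.range n ×ˢ Finset.range n) ×ˢ (Finset.univ : Finset (Fin r × Fin r)), f t =
      ∑ j : Fin r, ∑ i : Fin r, ∑ a ∈ Finset.range n, ∑ b ∈ Finset.range n,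
        f ((a, b), (i, j)) := by
  rw [Finset.sum_product_right, Fintype.sum_prod_type_right]
  simp only [Finset.sum_product]

/-- Scalar kernel with coefficients read off from those of a matrix-valued kernel. -/
def scalarKernel (r n : ℕ) (c : ℕ → ℕ → Fin r → Fin r → ℂ) (w z : ℂ) : ℂ :=
  ∑ t ∈ (Finset.range n ×ˢ Finset.range n) ×ˢ (Finset.univ : Finset (Fin r × Fin r)),
    c t.1.1 t.1.2 t.2.1 t.2.2 *
      (w ^ (r * t.1.1 + (r - 1 - (t.2.1 : ℕ))) * z ^ (r * t.1.2 + (t.2.2 : ℕ)))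

theorem Nat.mul_add_le_mul_sub_one {r n a k : ℕ} (ha : a < n) (hk : k < r) :
    r * a + k ≤ r * n - 1 := by
  have : r * (a + 1) ≤ r * n := Nat.mul_le_mul_left r ha
  rw [Nat.mul_succ] at this
  omega

open Finset in
theorem isLeftRKCircleS_scalarKernel {r m n L M N : ℕ} (hr : 2 ≤ r) (hn : 1 ≤ n)
    (hM : M = r * m) (hN : N = r * n) {K : ℂ → ℂ → Matrix (Fin r) (Fin r) ℂ}
    (hK : IsLeftRKCircleM r n 1 (fun z => z ^ (-((m + n : ℕ) : ℤ)) • Amat r z ^ L) K)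
    {c : ℕ → ℕ → Fin r → Fin r → ℂ}
    (hc : ∀ w z i j, K w z i j =
      ∑ a ∈ range n, ∑ b ∈ range n, c a b i j * (w ^ a * z ^ b)) :
    IsLeftRKCircleS (r * n) 1 (fun z => (1 + z) ^ L * z ^ (-((M + N : ℕ) : ℤ)))
      (scalarKernel r n c) := by
  refine ⟨fun z => ?_, fun w => ?_, ?_⟩
  · refine IsPolyDeg.sum_s15 _ fun t ht => ?_
    simp only [mem_product, mem_range] at ht
    have := isPolyDeg_const_mul_pow (d := r * n - 1)
      (Nat.mul_add_le_mul_sub_one (k := r - 1 - (t.2.1 : ℕ)) ht.1.1 (by omega))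
      (c t.1.1 t.1.2 t.2.1 t.2.2 * z ^ (r * t.1.2 + (t.2.2 : ℕ)))
    convert this using 2
    ring
  · refine IsPolyDeg.sum_s15 _ fun t ht => ?_
    simp only [mem_product, mem_range] at ht
    have := isPolyDeg_const_mul_pow (d := r * n - 1)
      (Nat.mul_add_le_mul_sub_one ht.1.2 t.2.2.2)
      (c t.1.1 t.1.2 t.2.1 t.2.2 * w ^ (r * t.1.1 + (r - 1 - (t.2.1 : ℕ))))
    convert this using 2
    ring
  have hmat : ∀ e < n, ∀ (i j : Fin r) (z : ℂ),
      ∑ l : Fin r, ∑ a ∈ range n, ∑ b ∈ range n, c a b l j * z ^ b *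
        circleIntegral (fun w => w ^ ((e : ℤ) - (m + n : ℕ) + a) * (Amat r w ^ L) i l) 0 1 =
      if i = j then z ^ e else 0 := by
    intro e he i j z
    have hP : IsMatPoly r r (n - 1) fun w => w ^ e • (1 : Matrix (Fin r) (Fin r) ℂ) := by
      refine ⟨fun l => if l = e then 1 else 0, fun w => ?_⟩
      rw [sum_eq_single e]
      · simp
      · intro b _ hb; simp [hb]
      · intro h; exact absurd (mem_range.2 (by omega)) h
    have h := congrFun (congrFun (hK.2.2 _ hP z) i) j
    simp only [circleIntegralM, Matrix.of_apply, Matrix.smul_apply, Matrix.one_apply,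
      smul_eq_mul, mul_ite, mul_one, mul_zero] at h
    rw [← h, circleIntegral_congr_unit (g := fun w => ∑ t ∈ univ ×ˢ (range n ×ˢ range n),
      (c t.2.1 t.2.2 t.1 j * z ^ t.2.2) *
        (w ^ ((e : ℤ) - (m + n : ℕ) + t.2.1) * (Amat r w ^ L) i t.1)),
      circleIntegral_sum_const_mul]
    · simp only [sum_product]
    · exact fun t _ => circleIntegrable_zpow_mul _ (continuous_Amat_pow_apply r L i t.1)
    · intro w hw
      simp only [sum_product, Matrix.smul_mul, Matrix.one_mul, Matrix.mul_smul,
        Matrix.smul_apply, Matrix.mul_apply, smul_eq_mul, hc, mul_sum]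
      refine sum_congr rfl fun l _ => sum_congr rfl fun a _ => sum_congr rfl fun b _ => ?_
      rw [sub_eq_add_neg, zpow_add₀ hw, zpow_add₀ hw, zpow_natCast, zpow_natCast]
      ring
  intro p hp z
  obtain ⟨q, hq⟩ := hp
  have hrn : r * n - 1 + 1 = r * n := Nat.sub_add_cancel (Nat.mul_pos (by omega) hn)
  rw [hrn] at hq
  have hmom : ∀ l < r * n, ∑ t ∈ (range n ×ˢ range n) ×ˢ (univ : Finset (Fin r × Fin r)),
      (c t.1.1 t.1.2 t.2.1 t.2.2 * z ^ (r * t.1.2 + (t.2.2 : ℕ))) *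
        circleIntegral (fun w => w ^ ((l : ℤ) - (M + N : ℕ) + (r * t.1.1 + (r - 1 -
          (t.2.1 : ℕ)) : ℕ)) * (1 + w) ^ L) 0 1 = z ^ l := by
    intro l hl
    have hl' : l / r < n := Nat.div_lt_of_lt_mul hl
    have hlr : l % r < r := Nat.mod_lt _ (by omega)
    have h := fun j => hmat (l / r) hl' ⟨l % r, hlr⟩ j (z ^ r)
    have h' : ∑ j : Fin r, z ^ (j : ℕ) * (if (⟨l % r, hlr⟩ : Fin r) = j then
        (z ^ r) ^ (l / r) else 0) = z ^ l := by
      simp only [mul_ite, mul_zero, sum_ite_eq, mem_univ, if_true]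
      rw [← pow_mul, ← pow_add, Nat.mod_add_div]
    rw [← h']
    simp only [← h, mul_sum]
    rw [sum_range_product_fin]
    refine sum_congr rfl fun j _ => sum_congr rfl fun i _ => sum_congr rfl fun a _ =>
      sum_congr rfl fun b _ => ?_
    rw [← circleIntegral_zpow_mul_Amat_pow hr L ((l / r : ℕ) - (m + n : ℕ) + a) _
      ⟨l % r, hlr⟩ i]
    · ring
    · have := i.2
      have hlm : ((l : ℕ) : ℤ) = (r : ℤ) * ((l / r : ℕ) : ℤ) + ((l % r : ℕ) : ℤ) := by
        exact_mod_cast (Nat.div_add_mod l r).symm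
      rw [hlm, hM, hN, Nat.cast_add (r * a), Nat.sub_sub, Nat.cast_sub (by omega)]
      push_cast
      ring
  rw [circleIntegral_congr_unit (g := fun w => ∑ u ∈ range (r * n) ×ˢ
      ((range n ×ˢ range n) ×ˢ (univ : Finset (Fin r × Fin r))),
      (q u.1 * (c u.2.1.1 u.2.1.2 u.2.2.1 u.2.2.2 * z ^ (r * u.2.1.2 + (u.2.2.2 : ℕ)))) *
        (w ^ ((u.1 : ℤ) - (M + N : ℕ) + (r * u.2.1.1 + (r - 1 -
          (u.2.2.1 : ℕ)) : ℕ)) * (1 + w) ^ L)),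
    circleIntegral_sum_const_mul, sum_product, hq z]
  · refine sum_congr rfl fun l hl => ?_
    rw [← hmom l (mem_range.1 hl), mul_sum]
    exact sum_congr rfl fun t _ => by simp only [mul_assoc]
  · exact fun u _ => circleIntegrable_zpow_mul _ (by fun_prop)
  · intro w hw
    rw [hq, sum_product, sum_mul, sum_mul]
    refine sum_congr rfl fun l _ => ?_
    rw [scalarKernel, mul_sum]
    refine sum_congr rfl fun t _ => ?_
    rw [sub_eq_add_neg, zpow_add₀ hw, zpow_add₀ hw, zpow_natCast, zpow_natCast]
    ring

/-- The correlation kernel of the uniform lozenge tiling model, written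
via the scalar reproducing kernel for `W̃(z) = (1+z)^L z^{-M-N}`, agrees with the entry of
the matrix formula coming from viewing the model as `r × 1` periodic. -/
theorem stmt15 (r m n L M N : ℕ) (hr : 2 ≤ r) (hm : 1 ≤ m) (hn : 1 ≤ n) (hL : 2 ≤ L)
    (hM : M = r * m) (hN : N = r * n)
    (K : ℂ → ℂ → Matrix (Fin r) (Fin r) ℂ)
    (hK : IsLeftRKCircleM r n 1
      (fun z => z ^ (-((m + n : ℕ) : ℤ)) • Amat r z ^ L) K)
    (Ks : ℂ → ℂ → ℂ)
    (hKs : IsLeftRKCircleS (r * n) 1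
      (fun z => (1 + z) ^ L * z ^ (-((M + N : ℕ) : ℤ))) Ks)
    (hKsU : ∀ Ks' : ℂ → ℂ → ℂ,
      IsLeftRKCircleS (r * n) 1
        (fun z => (1 + z) ^ L * z ^ (-((M + N : ℕ) : ℤ))) Ks' → Ks' = Ks)
    (x₁ x₂ y₁ y₂ : ℤ)
    (hx₁ : 1 ≤ x₁ ∧ x₁ ≤ (L : ℤ) - 1) (hx₂ : 1 ≤ x₂ ∧ x₂ ≤ (L : ℤ) - 1) :
    (1 / (2 * (Real.pi : ℂ) * Complex.I)) *
        circleIntegral (fun w => circleIntegral (fun z =>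
          (1 + w) ^ ((L : ℤ) - x₂) * w ^ (y₂ - (M : ℤ) - (N : ℤ)) * Ks w z *
            (1 + z) ^ x₁ * z ^ (-y₁ - 1)) 0 1) 0 1
      - ((if x₂ < x₁ then (1 : ℂ) else 0) / (2 * (Real.pi : ℂ) * Complex.I)) *
        circleIntegral (fun z => (1 + z) ^ (x₁ - x₂) * z ^ (y₂ - y₁ - 1)) 0 1
    = (1 / (2 * (Real.pi : ℂ) * Complex.I)) *
        circleIntegral (fun w => circleIntegral (fun z =>
          w ^ (y₂ / (r : ℤ) - (m : ℤ) - (n : ℤ)) *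
            ((Amat r w ^ ((L : ℤ) - x₂).toNat * K w z * Amat r z ^ x₁.toNat)
              (modIdx r (by omega) y₂) (modIdx r (by omega) y₁)) *
            z ^ (-(y₁ / (r : ℤ)) - 1)) 0 1) 0 1
      - ((if x₂ < x₁ then (1 : ℂ) else 0) / (2 * (Real.pi : ℂ) * Complex.I)) *
        circleIntegral (fun z =>
          (Amat r z ^ (x₁ - x₂).toNat) (modIdx r (by omega) y₂) (modIdx r (by omega) y₁) *
            z ^ (y₂ / (r : ℤ) - y₁ / (r : ℤ) - 1)) 0 1 := by
  obtain ⟨c, hc⟩ : ∃ c : ℕ → ℕ → Fin r → Fin r → ℂ, ∀ w z i j, K w z i j =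
      ∑ a ∈ Finset.range n, ∑ b ∈ Finset.range n, c a b i j * (w ^ a * z ^ b) := by
    have h : ∀ i j, ∃ c : ℕ → ℕ → ℂ, ∀ w z, K w z i j = _ := fun i j =>
      exists_coeff_of_isPolyDeg_isPolyDeg (f := fun w z => K w z i j)
        (fun z => (hK.1 z).apply i j) (fun w => (hK.2.1 w).apply i j)
    choose c hc using h
    refine ⟨fun a b i j => c i j a b, fun w z i j => ?_⟩
    rw [hc, Nat.sub_add_cancel hn]
  have hKs' := hKsU _ (isLeftRKCircleS_scalarKernel hr hn hM hN hK hc)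
  subst hKs'
  obtain ⟨k₁, rfl⟩ := Int.eq_ofNat_of_zero_le (show 0 ≤ x₁ by omega)
  obtain ⟨k₂, hk₂⟩ := Int.eq_ofNat_of_zero_le (show 0 ≤ (L : ℤ) - x₂ by omega)
  have hmod : ∀ y : ℤ, (((modIdx r (by omega) y : Fin r) : ℕ) : ℤ) = y - r * (y / r) := by
    intro y
    have := Int.emod_nonneg y (show (r : ℤ) ≠ 0 by omega)
    rw [modIdx, Int.toNat_of_nonneg this, Int.emod_def]
  have hM' : (M : ℤ) = r * m := by exact_mod_cast hM
  have hN' : (N : ℤ) = r * n := by exact_mod_cast hN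
  rw [hk₂]
  simp only [zpow_natCast, Int.toNat_natCast]
  congr 1
  · congr 1
    rw [circleIntegral_circleIntegral_of_eq_sum
        ((Finset.range n ×ˢ Finset.range n) ×ˢ (Finset.univ : Finset (Fin r × Fin r)))
        (fun t => c t.1.1 t.1.2 t.2.1 t.2.2)
        (u := fun t w => w ^ (y₂ - (M : ℤ) - (N : ℤ) +
          (r * t.1.1 + (r - 1 - (t.2.1 : ℕ)) : ℕ)) * (1 + w) ^ k₂)
        (v := fun t z => z ^ (-y₁ - 1 + (r * t.1.2 + (t.2.2 : ℕ) : ℕ)) * (1 + z) ^ k₁),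
      circleIntegral_circleIntegral_of_eq_sum
        ((Finset.range n ×ˢ Finset.range n) ×ˢ (Finset.univ : Finset (Fin r × Fin r)))
        (fun t => c t.1.1 t.1.2 t.2.1 t.2.2)
        (u := fun t w => w ^ (y₂ / (r : ℤ) - (m : ℤ) - (n : ℤ) + t.1.1) *
          (Amat r w ^ k₂) (modIdx r (by omega) y₂) t.2.1)
        (v := fun t z => z ^ (-(y₁ / (r : ℤ)) - 1 + t.1.2) *
          (Amat r z ^ k₁) t.2.2 (modIdx r (by omega) y₁))]
    · refine Finset.sum_congr rfl fun t _ => ?_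
      congr 2
      · refine (circleIntegral_zpow_mul_Amat_pow hr _ _ _ _ _ ?_).symm
        have := t.2.1.2
        rw [hmod, hM', hN', Nat.cast_add, Nat.sub_sub, Nat.cast_sub (by omega)]
        push_cast
        ring
      · refine (circleIntegral_zpow_mul_Amat_pow hr _ _ _ _ _ ?_).symm
        rw [hmod]
        push_cast
        ring
    · exact fun t _ => circleIntegrable_zpow_mul _ (continuous_Amat_pow_apply _ _ _ _)
    · exact fun t _ => circleIntegrable_zpow_mul _ (continuous_Amat_pow_apply _ _ _ _)
    · intro w hw z hz
      simp only [zpow_add₀ hw, zpow_add₀ hz, zpow_natCast, Matrix.mul_apply, hc,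
        Finset.mul_sum, Finset.sum_mul]
      rw [sum_range_product_fin]
      exact Finset.sum_congr rfl fun j _ => Finset.sum_congr rfl fun l _ =>
        Finset.sum_congr rfl fun a _ => Finset.sum_congr rfl fun b _ => by ring
    · exact fun t _ => circleIntegrable_zpow_mul _ (by fun_prop)
    · exact fun t _ => circleIntegrable_zpow_mul _ (by fun_prop)
    · intro w hw z hz
      simp only [zpow_add₀ hw, zpow_add₀ hz, zpow_natCast, scalarKernel, Finset.mul_sum,
        Finset.sum_mul]
      exact Finset.sum_congr rfl fun t _ => by ring
  · split_ifs with h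
    · congr 1
      obtain ⟨k, hk⟩ := Int.eq_ofNat_of_zero_le (show 0 ≤ (k₁ : ℤ) - x₂ by omega)
      rw [hk]
      simp only [zpow_natCast, Int.toNat_natCast]
      simp only [mul_comm _ (_ ^ (_ : ℤ))]
      refine (circleIntegral_zpow_mul_Amat_pow hr _ _ _ _ _ ?_).symm
      rw [hmod, hmod]
      ring
    · simp
end
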